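/- Let T₁ and T₂ be two spanning trees on the same vertex set of d vertices, and let E = T₁∖T₂ = {e₁,…,e_l} and F = T₂∖T₁ = {f₁,…,f_l} be the two sides of the symmetric difference of their edge sets. Then there is a bijection π : E → F such that for every e ∈ E, the edge set (T₁∖{e}) ∪ {π(e)} is again a spanning tree. -/

import Mathlib

/-- A finite edge set is a spanning tree on `V` if it has no loops and the
graph it generates is a tree (connected and acyclic) on all of `V`. -/
def IsSpanningTreeEdges {V : Type*} (T : Finset (Sym2 V)) : Prop :=
  (∀ e ∈ T, ¬ e.IsDiag) ∧ (SimpleGraph.fromEdgeSet (↑T : Set (Sym2 V))).IsTree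

namespace SimpleGraph

/-- In an acyclic graph, the path between two vertices stays inside every subgraph in which
these vertices are still reachable from one another. -/
theorem IsAcyclic.edges_subset_edgeSet_of_reachable {V : Type*} {G H : SimpleGraph V} {u v : V}
    (hG : G.IsAcyclic) (hHG : H ≤ G) {p : G.Walk u v} (hp : p.IsPath) (h : H.Reachable u v)
    {e : Sym2 V} (he : e ∈ p.edges) : e ∈ H.edgeSet := by
  obtain ⟨q, hq⟩ := h.exists_isPath
  have hpq : p = q.mapLe hHG :=
    congrArg Subtype.val
      ((hG.subsingleton_path u v).elim ⟨p, hp⟩ ⟨q.mapLe hHG, hq.mapLe hHG⟩)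
  rw [hpq, Walk.edges_mapLe_eq_edges] at he
  exact q.edges_subset_edgeSet he

end SimpleGraph

section SpanningTree

open SimpleGraph

variable {V : Type*}

theorem edgeSet_fromEdgeSet_of_loopless {T : Finset (Sym2 V)} (hT : ∀ e ∈ T, ¬ e.IsDiag) :
    (fromEdgeSet (T : Set (Sym2 V))).edgeSet = T := by
  rw [edgeSet_fromEdgeSet, sdiff_eq_left, Set.disjoint_left]
  exact fun e he => hT e he

theorem IsSpanningTreeEdges.card_add_one [Fintype V] {T : Finset (Sym2 V)}
    (hT : IsSpanningTreeEdges T) : T.card + 1 = Fintype.card V := by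
  have h := (isTree_iff_connected_and_card.mp hT.2).2
  rwa [edgeSet_fromEdgeSet_of_loopless hT.1, Nat.card_coe_set_eq,
    Set.ncard_coe_finset, Nat.card_eq_fintype_card] at h

theorem IsSpanningTreeEdges.card_eq [Fintype V] {S T : Finset (Sym2 V)}
    (hS : IsSpanningTreeEdges S) (hT : IsSpanningTreeEdges T) : S.card = T.card :=
  Nat.succ_injective (hS.card_add_one.trans hT.card_add_one.symm)

/-- An acyclic edge set inside a connected graph extends to a spanning tree of that graph. -/
theorem exists_isSpanningTreeEdges_of_isAcyclic [Finite V] {A : Finset (Sym2 V)}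
    {G : SimpleGraph V} (hA : ∀ e ∈ A, ¬ e.IsDiag)
    (hacyc : (fromEdgeSet (A : Set (Sym2 V))).IsAcyclic) (hG : G.Connected)
    (hAG : fromEdgeSet (A : Set (Sym2 V)) ≤ G) :
    ∃ T : Finset (Sym2 V), A ⊆ T ∧ (T : Set (Sym2 V)) ⊆ G.edgeSet ∧ IsSpanningTreeEdges T := by
  obtain ⟨F, hAF, hFG, hF⟩ := hG.exists_isTree_le_of_le_of_isAcyclic hAG hacyc
  have hcoe : ((Set.toFinite F.edgeSet).toFinset : Set (Sym2 V)) = F.edgeSet :=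
    Set.Finite.coe_toFinset _
  refine ⟨(Set.toFinite F.edgeSet).toFinset, ?_, ?_, ?_, ?_⟩
  · rw [← Finset.coe_subset, hcoe, ← edgeSet_fromEdgeSet_of_loopless hA]
    exact edgeSet_mono hAF
  · rw [hcoe]
    exact edgeSet_mono hFG
  · exact fun e he => F.not_isDiag_of_mem_edgeSet ((Set.Finite.mem_toFinset _).mp he)
  · rwa [hcoe, fromEdgeSet_edgeSet]

variable [Fintype V] [DecidableEq V]

/-- Replacing an edge of a spanning tree by a pair of vertices which the deletion of that edge
separates yields a spanning tree. -/
theorem IsSpanningTreeEdges.insert_erase {T : Finset (Sym2 V)} (hT : IsSpanningTreeEdges T)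
    {e : Sym2 V} (he : e ∈ T) {u v : V}
    (huv : ¬ (fromEdgeSet (T.erase e : Set (Sym2 V))).Reachable u v) :
    IsSpanningTreeEdges (insert s(u, v) (T.erase e)) := by
  have hne : u ≠ v := fun h => huv (h ▸ Reachable.refl _)
  have hloop : ∀ f ∈ insert s(u, v) (T.erase e), ¬ f.IsDiag := by
    intro f hf
    rcases Finset.mem_insert.mp hf with rfl | hf
    · simpa using hne
    · exact hT.1 f (Finset.mem_of_mem_erase hf)
  have hnot : s(u, v) ∉ T.erase e := fun h =>
    huv (Adj.reachable ((fromEdgeSet_adj _).mpr ⟨Finset.mem_coe.mpr h, hne⟩))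
  have hacyc : (fromEdgeSet
      ((insert s(u, v) (T.erase e) : Finset (Sym2 V)) : Set (Sym2 V))).IsAcyclic := by
    have h := (hT.2.isAcyclic.anti (fromEdgeSet_mono (Finset.coe_subset.mpr
      (Finset.erase_subset e T)))).sup_edge_of_not_reachable huv
    rwa [edge, ← fromEdgeSet_union, Set.union_singleton, ← Finset.coe_insert] at h
  have : Nonempty V := ⟨u⟩
  obtain ⟨S, hsub, -, hS⟩ :=
    exists_isSpanningTreeEdges_of_isAcyclic hloop hacyc connected_top le_top
  have hcard : S.card ≤ (insert s(u, v) (T.erase e)).card := by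
    rw [Finset.card_insert_of_notMem hnot, Finset.card_erase_add_one he, hS.card_eq hT]
  rwa [Finset.eq_of_subset_of_card_le hsub hcard]

/-- Hall's condition for tree exchange: for a set `S` of edges of `T₁` outside `T₂` there are
`S.card` edges of `T₂` outside `T₁`, each of which can replace some edge of `S` in `T₁`. -/
theorem exists_card_eq_forall_exists_exchange {T₁ T₂ S : Finset (Sym2 V)}
    (h1 : IsSpanningTreeEdges T₁) (h2 : IsSpanningTreeEdges T₂) (hS : S ⊆ T₁ \ T₂) :
    ∃ A ⊆ T₂ \ T₁, A.card = S.card ∧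
      ∀ f ∈ A, ∃ e ∈ S, IsSpanningTreeEdges (insert f (T₁.erase e)) := by
  have hST₁ : S ⊆ T₁ := hS.trans Finset.sdiff_subset
  have hmono : fromEdgeSet ((T₁ \ S : Finset _) : Set (Sym2 V)) ≤ fromEdgeSet (T₁ : Set (Sym2 V)) :=
    fromEdgeSet_mono (Finset.coe_subset.mpr Finset.sdiff_subset)
  obtain ⟨T, hsub, hle, hT⟩ := exists_isSpanningTreeEdges_of_isAcyclic
    (A := T₁ \ S) (G := fromEdgeSet (T₂ : Set (Sym2 V)) ⊔ fromEdgeSet ((T₁ \ S : Finset _)))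
    (fun e he => h1.1 e (Finset.sdiff_subset he)) (h1.2.isAcyclic.anti hmono)
    (h2.2.connected.mono le_sup_left) le_sup_right
  refine ⟨T \ (T₁ \ S), ?_, ?_, ?_⟩
  · intro f hf
    obtain ⟨hfT, hf⟩ := Finset.mem_sdiff.mp hf
    have hfG := hle hfT
    rw [← fromEdgeSet_union, edgeSet_fromEdgeSet] at hfG
    have hf₂ : f ∈ T₂ := hfG.1.resolve_right hf
    refine Finset.mem_sdiff.mpr ⟨hf₂, fun hf₁ => hf (Finset.mem_sdiff.mpr ⟨hf₁, fun hfS => ?_⟩)⟩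
    exact (Finset.mem_sdiff.mp (hS hfS)).2 hf₂
  · have h := Finset.card_sdiff_add_card_eq_card hsub
    have h' := Finset.card_sdiff_add_card_eq_card hST₁
    have := hT.card_eq h1
    omega
  · intro f hf
    obtain ⟨hfT, hf⟩ := Finset.mem_sdiff.mp hf
    induction f with | _ u v
    have hsep : ¬ (fromEdgeSet ((T₁ \ S : Finset _) : Set (Sym2 V))).Reachable u v := by
      have hbridge := isAcyclic_iff_forall_isBridge.mp hT.2.isAcyclic
        ((edgeSet_fromEdgeSet_of_loopless hT.1).symm ▸ Finset.mem_coe.mpr hfT)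
      refine fun h => isBridge_iff.mp hbridge (h.mono ?_)
      intro a b hab
      rw [fromEdgeSet_adj] at hab
      rw [deleteEdges_adj, fromEdgeSet_adj]
      exact ⟨⟨hsub hab.1, hab.2⟩, fun h => hf (h ▸ hab.1)⟩
    by_contra! hno
    obtain ⟨p, hp⟩ := (h1.2.connected u v).exists_isPath
    refine hsep ⟨p.transfer _ fun e he => ?_⟩
    have heT := p.edges_subset_edgeSet he
    rw [edgeSet_fromEdgeSet_of_loopless h1.1] at heT
    rw [edgeSet_fromEdgeSet_of_loopless fun e he => h1.1 e (Finset.sdiff_subset he)]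
    refine Finset.mem_coe.mpr (Finset.mem_sdiff.mpr ⟨heT, fun heS => ?_⟩)
    have hreach : (fromEdgeSet (T₁.erase e : Set (Sym2 V))).Reachable u v :=
      not_not.mp fun h => hno e heS (h1.insert_erase heT h)
    have := h1.2.isAcyclic.edges_subset_edgeSet_of_reachable
      (fromEdgeSet_mono (Finset.coe_subset.mpr (Finset.erase_subset e T₁))) hp hreach he
    rw [edgeSet_fromEdgeSet] at this
    exact Finset.notMem_erase e T₁ this.1

end SpanningTree

/-- Spanning tree exchange: the two sides of the symmetric difference of two
spanning trees can be paired up so that each single swap yields a spanning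
tree. -/
theorem stmt_10 {V : Type*} [Fintype V] [DecidableEq V]
    (T₁ T₂ : Finset (Sym2 V))
    (h1 : IsSpanningTreeEdges T₁) (h2 : IsSpanningTreeEdges T₂) :
    ∃ π : {e // e ∈ T₁ \ T₂} → {f // f ∈ T₂ \ T₁},
      Function.Bijective π ∧
      ∀ e : {e // e ∈ T₁ \ T₂},
        IsSpanningTreeEdges (insert (π e).1 (T₁.erase e.1)) := by
  classical
  have hall := (Fintype.all_card_le_filter_rel_iff_exists_injective
    fun (e : {e // e ∈ T₁ \ T₂}) (f : {f // f ∈ T₂ \ T₁}) =>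
      IsSpanningTreeEdges (insert f.1 (T₁.erase e.1))).mp ?_
  · obtain ⟨π, hinj, hπ⟩ := hall
    refine ⟨π, (Fintype.bijective_iff_injective_and_card π).mpr ⟨hinj, ?_⟩, hπ⟩
    rw [Fintype.card_coe, Fintype.card_coe]
    exact Finset.card_sdiff_comm (h1.card_eq h2)
  · intro S
    obtain ⟨A, hA, hcard, hex⟩ := exists_card_eq_forall_exists_exchange (S := S.map (.subtype _))
      h1 h2 fun e he => Finset.property_of_mem_map_subtype S he
    rw [Finset.card_map] at hcard
    rw [← hcard, ← Finset.card_attach]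
    refine Finset.card_le_card_of_injOn (fun f => ⟨f.1, hA f.2⟩) ?_ ?_
    · intro f _
      obtain ⟨e, he, hef⟩ := hex f.1 f.2
      obtain ⟨e', he', rfl⟩ := Finset.mem_map.mp he
      exact Finset.mem_coe.mpr (Finset.mem_filter.mpr ⟨Finset.mem_univ _, e', he', hef⟩)
    · exact fun f _ g _ hfg => Subtype.ext (Subtype.mk.inj hfg)
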